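/- arXiv:math/0603295 — 4 statements merged into one kernel-verified Lean document; each statement's English description precedes it below -/
import Mathlib

section
/- Let E and F be finite-dimensional real normed vector spaces, let D ⊂ E be an open subset, and let f : D → F be an infinitely differentiable function such that f(D) has non-empty interior in F. Then f has at least one regular point, i.e., there exists x_0 ∈ D such that the derivative Df(x_0) : E → F is surjective. -/
open Set Topology
open scoped ContDiff

theorem isMeagre_image_of_locally {X Y : Type*} [TopologicalSpace X]
    [SecondCountableTopology X] [TopologicalSpace Y] {f : X → Y} {S : Set X}
    (h : ∀ x ∈ S, ∃ V ∈ 𝓝 x, IsMeagre (f '' (S ∩ V))) : IsMeagre (f '' S) := by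
  choose! V hV hm using h
  obtain ⟨t, htS, htc, hcov⟩ := TopologicalSpace.countable_cover_nhdsWithin
    (f := V) (s := S) fun x hx => mem_nhdsWithin_of_mem_nhds (hV x hx)
  have := htc.to_subtype
  refine IsMeagre.mono ?_ (isMeagre_iUnion fun x : t => hm x (htS x.2))
  rintro _ ⟨x, hx, rfl⟩
  obtain ⟨y, hy, hxy⟩ := mem_iUnion₂.1 (hcov hx)
  exact mem_iUnion.2 ⟨⟨y, hy⟩, x, ⟨hx, hxy⟩, rfl⟩

theorem IsCompact.isMeagre_of_interior_eq_empty {Y : Type*} [TopologicalSpace Y] [T2Space Y]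
    {K : Set Y} (hK : IsCompact K) (h : interior K = ∅) : IsMeagre K :=
  (hK.isClosed.isNowhereDense_iff.2 h).isMeagre

section

variable {E : Type*} [NormedAddCommGroup E] [NormedSpace ℝ E]
  {F : Type*} [NormedAddCommGroup F] [NormedSpace ℝ F]

theorem isOpen_setOf_surjective [FiniteDimensional ℝ F] :
    IsOpen {T : E →L[ℝ] F | Function.Surjective T} := by
  refine isOpen_iff_mem_nhds.2 fun T hT => ?_
  obtain ⟨R, hR⟩ := (T : E →ₗ[ℝ] F).exists_rightInverse_of_surjective (LinearMap.range_eq_top.2 hT)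
  let R' : F →L[ℝ] E := R.toContinuousLinearMap
  have hTR : T ∘L R' = 1 := by
    ext x
    exact congrArg (fun S => S x) hR
  have hcont : Continuous fun S : E →L[ℝ] F => S ∘L R' := by fun_prop
  have : CompleteSpace F := FiniteDimensional.complete ℝ F
  have hopen := (Units.isOpen (R := F →L[ℝ] F)).preimage hcont
  refine Filter.mem_of_superset (hopen.mem_nhds (x := T) ?_) ?_
  · change IsUnit (T ∘L R')
    rw [hTR]
    exact isUnit_one
  · rintro S ⟨u, hu⟩ y
    refine ⟨R' ((↑u⁻¹ : F →L[ℝ] F) y), ?_⟩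
    change (S ∘L R') _ = y
    rw [← show (u : F →L[ℝ] F) = S ∘L R' from hu]
    exact congrArg (fun S => S y) u.mul_inv

/-- A smooth real function with non-vanishing derivative at a point is the first coordinate of a
local diffeomorphism. -/
theorem exists_straightening [FiniteDimensional ℝ E] {w : E → ℝ} {U : Set E} (hU : IsOpen U)
    (hw : ∀ x ∈ U, ContDiffAt ℝ ∞ w x) {x₀ : E} (hx₀ : x₀ ∈ U) (h : fderiv ℝ w x₀ ≠ 0) :
    ∃ N : Submodule ℝ E, Module.finrank ℝ N < Module.finrank ℝ E ∧
      ∃ Φ : OpenPartialHomeomorph E (ℝ × N),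
      x₀ ∈ Φ.source ∧ Φ.source ⊆ U ∧ (∀ x ∈ Φ.source, (Φ x).1 = w x) ∧
      ∀ p ∈ Φ.target, ContDiffAt ℝ ∞ Φ.symm p := by
  set L := fderiv ℝ w x₀ with hL
  obtain ⟨v, hv⟩ : ∃ v, L v = 1 := by
    obtain ⟨u, hu⟩ : ∃ u, L u ≠ 0 := by
      by_contra! h0
      exact h (ContinuousLinearMap.ext h0)
    exact ⟨(L u)⁻¹ • u, by simp [hu]⟩
  let P : E →L[ℝ] L.ker :=
    (ContinuousLinearMap.id ℝ E - L.smulRight v).codRestrict L.ker (by intro x; simp [hv])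
  have hP : ∀ x, ((P x : L.ker) : E) = x - L x • v := fun x => rfl
  let e : E ≃L[ℝ] ℝ × L.ker := ContinuousLinearEquiv.equivOfInverse (L.prod P)
    ((ContinuousLinearMap.toSpanSingleton ℝ v).coprod L.ker.subtypeL)
    (by intro x; simp [hP])
    (by
      rintro ⟨s, n⟩
      have hn : L n = 0 := n.2
      ext <;> simp [hP, hv, hn])
  let Φ₀ : E → ℝ × L.ker := fun x => (w x, P x)
  have hs : ∀ x ∈ U, ContDiffAt ℝ ∞ Φ₀ x := fun x hx =>
    (hw x hx).prodMk P.contDiff.contDiffAt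
  have hder : HasFDerivAt Φ₀ (e : E →L[ℝ] ℝ × L.ker) x₀ :=
    ((hw x₀ hx₀).differentiableAt (by simp)).hasFDerivAt.prodMk P.hasFDerivAt
  let Φ := (hs x₀ hx₀).toOpenPartialHomeomorph Φ₀ hder (by simp)
  have hΦ : (Φ : E → ℝ × L.ker) = Φ₀ := rfl
  have hinv : ∀ᶠ x in 𝓝 x₀, fderiv ℝ Φ₀ x ∈
      range ((↑) : (E ≃L[ℝ] ℝ × L.ker) → E →L[ℝ] ℝ × L.ker) := by
    have hc : ContinuousAt (fderiv ℝ Φ₀) x₀ :=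
      ((hs x₀ hx₀).fderiv_right (m := 0) (by simp)).continuousAt
    refine hc.eventually_mem ?_
    rw [hder.fderiv]
    exact ContinuousLinearEquiv.nhds e
  obtain ⟨V, hVsub, hVo, hxV⟩ := eventually_nhds_iff.1 hinv
  have hker : Module.finrank ℝ L.ker < Module.finrank ℝ E := by
    refine Submodule.finrank_lt fun h' => h ?_
    ext x
    have : x ∈ L.ker := h' ▸ Submodule.mem_top
    exact this
  refine ⟨L.ker, hker, Φ.restrOpen (U ∩ V) (hU.inter hVo), ?_, ?_, ?_, ?_⟩
  · exact ⟨(hs x₀ hx₀).mem_toOpenPartialHomeomorph_source hder (by simp), hx₀, hxV⟩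
  · exact fun x hx => hx.2.1
  · exact fun x hx => rfl
  · intro p hp
    have hq := (Φ.restrOpen (U ∩ V) (hU.inter hVo)).map_target hp
    set q := (Φ.restrOpen (U ∩ V) (hU.inter hVo)).symm p
    obtain ⟨e', he'⟩ := hVsub q hq.2.2
    refine OpenPartialHomeomorph.contDiffAt_symm _ (f₀' := e') hp ?_ (hs q hq.2.1)
    rw [he']
    exact ((hs q hq.2.1).differentiableAt (by simp)).hasFDerivAt

/-- Flat points: if all derivatives of positive order vanish at `x`, then `f y - f x` is
`O(‖y - x‖ ^ (k + 1))`. -/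
theorem norm_sub_le_pow_of_iteratedFDeriv_eq_zero {f : E → F} {B : Set E} (hB : Convex ℝ B)
    (hf : ∀ x ∈ B, ContDiffAt ℝ ∞ f x) {k : ℕ} {C : ℝ} (hC : 0 ≤ C)
    (hbd : ∀ y ∈ B, ‖iteratedFDeriv ℝ (k + 1) f y‖ ≤ C) {x : E} (hx : x ∈ B)
    (hzero : ∀ i, 1 ≤ i → iteratedFDeriv ℝ i f x = 0) {y : E} (hy : y ∈ B) :
    ‖f y - f x‖ ≤ C * ‖y - x‖ ^ (k + 1) := by
  have hball : ∀ y ∈ B, Convex ℝ (B ∩ Metric.closedBall x ‖y - x‖) ∧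
      x ∈ B ∩ Metric.closedBall x ‖y - x‖ ∧ y ∈ B ∩ Metric.closedBall x ‖y - x‖ :=
    fun y hy => ⟨hB.inter (convex_closedBall _ _), ⟨hx, by simp⟩, hy, by simp [dist_eq_norm]⟩
  have key : ∀ m j : ℕ, 1 ≤ j → j + m = k + 1 → ∀ y ∈ B,
      ‖iteratedFDeriv ℝ j f y‖ ≤ C * ‖y - x‖ ^ m := by
    intro m
    induction m with
    | zero =>
      intro j _ hj y hy
      obtain rfl : j = k + 1 := hj
      simpa using hbd y hy
    | succ m ih =>
      intro j hj1 hj y hy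
      obtain ⟨hc, hxB, hyB⟩ := hball y hy
      have := Convex.norm_image_sub_le_of_norm_fderiv_le (𝕜 := ℝ) (f := iteratedFDeriv ℝ j f)
        (C := C * ‖y - x‖ ^ m)
        (fun z hz => ((hf z hz.1).iteratedFDeriv_right (m := 1) (i := j)
          (by exact_mod_cast le_top)).differentiableAt (by simp))
        (fun z hz => by
          rw [norm_fderiv_iteratedFDeriv]
          refine (ih (j + 1) (by omega) (by omega) z hz.1).trans ?_
          have : ‖z - x‖ ≤ ‖y - x‖ := by simpa [dist_eq_norm] using hz.2
          gcongr) hc hxB hyB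
      rw [hzero j hj1, sub_zero] at this
      rwa [pow_succ, ← mul_assoc]
  obtain ⟨hc, hxB, hyB⟩ := hball y hy
  rw [pow_succ, ← mul_assoc]
  refine Convex.norm_image_sub_le_of_norm_fderiv_le (𝕜 := ℝ)
    (fun z hz => (hf z hz.1).differentiableAt (by simp)) (fun z hz => ?_) hc hxB hyB
  rw [← norm_iteratedFDeriv_one]
  refine (key k 1 le_rfl (by omega) z hz.1).trans ?_
  have : ‖z - x‖ ≤ ‖y - x‖ := by simpa [dist_eq_norm] using hz.2
  gcongr

theorem isMeagre_image_flat [FiniteDimensional ℝ E] [FiniteDimensional ℝ F] [Nontrivial F]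
    {f : E → F} {U : Set E} (hU : IsOpen U) (hf : ∀ x ∈ U, ContDiffAt ℝ ∞ f x) :
    IsMeagre (f '' {x ∈ U | ∀ i, 1 ≤ i → iteratedFDeriv ℝ i f x = 0}) := by
  have : ProperSpace E := FiniteDimensional.proper_real E
  refine isMeagre_image_of_locally fun x₀ hx₀ => ?_
  obtain ⟨r, hr, hrU⟩ := Metric.nhds_basis_closedBall.mem_iff.1 (hU.mem_nhds hx₀.1)
  refine ⟨Metric.closedBall x₀ r, Metric.closedBall_mem_nhds x₀ hr, ?_⟩
  set B := Metric.closedBall x₀ r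
  have hBc : IsCompact B := isCompact_closedBall x₀ r
  have hcont : ∀ i, ContinuousOn (iteratedFDeriv ℝ i f) B := fun i z hz =>
    ((hf z (hrU hz)).iteratedFDeriv_right (m := 0) (i := i)
      (by exact_mod_cast le_top)).continuousAt.continuousWithinAt
  set S := {x ∈ U | ∀ i, 1 ≤ i → iteratedFDeriv ℝ i f x = 0} ∩ B
  have hS : S = B ∩ ⋂ i : ℕ, ⋂ _ : 1 ≤ i, B ∩ iteratedFDeriv ℝ i f ⁻¹' {0} := by
    ext z
    simp only [S, mem_inter_iff, mem_ofPred_eq, mem_iInter, mem_preimage, mem_singleton_iff]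
    exact ⟨fun h => ⟨h.2, fun i hi => ⟨h.2, h.1.2 i hi⟩⟩,
      fun h => ⟨⟨hrU h.1, fun i hi => (h.2 i hi).2⟩, h.1⟩⟩
  have hSc : IsCompact S := by
    rw [hS]
    exact hBc.inter_right <| isClosed_iInter fun i => isClosed_iInter fun _ =>
      (hcont i).preimage_isClosed_of_isClosed hBc.isClosed isClosed_singleton
  have hfS : ContinuousOn f S := fun z hz => (hf z hz.1.1).continuousAt.continuousWithinAt
  refine (hSc.image_of_continuousOn hfS).isMeagre_of_interior_eq_empty ?_
  rw [interior_eq_empty_iff_dense_compl]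
  apply dense_compl_of_dimH_lt_finrank
  set n := Module.finrank ℝ E
  obtain ⟨C, hC⟩ := hBc.exists_bound_of_continuousOn (hcont (n + 1))
  have hH : HolderOnWith C.toNNReal (n + 1 : ℕ) f S := by
    intro x hx y hy
    have hC0 : 0 ≤ C := (norm_nonneg _).trans (hC x hx.2)
    have := norm_sub_le_pow_of_iteratedFDeriv_eq_zero (convex_closedBall x₀ r)
      (fun z hz => hf z (hrU hz)) hC0 hC hy.2 hy.1.2 hx.2
    rw [edist_dist, edist_dist, dist_eq_norm, dist_eq_norm]
    simp only [NNReal.coe_natCast, ENNReal.rpow_natCast]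
    rw [← ENNReal.ofReal_pow (norm_nonneg _)]
    change _ ≤ ENNReal.ofReal C * _
    rw [← ENNReal.ofReal_mul hC0]
    exact ENNReal.ofReal_le_ofReal this
  have hF : (1 : ENNReal) ≤ Module.finrank ℝ F := by
    exact_mod_cast Module.finrank_pos (R := ℝ) (M := F)
  calc dimH (f '' S) ≤ dimH S / ((n + 1 : ℕ) : NNReal) := hH.dimH_image_le (by positivity)
    _ ≤ (n : ENNReal) / ((n + 1 : ℕ) : NNReal) := by
        gcongr
        exact (dimH_mono (subset_univ _)).trans (Real.dimH_univ_eq_finrank E).le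
    _ < 1 := by
        rw [ENNReal.div_lt_iff (by simp) (by simp), one_mul]
        exact_mod_cast Nat.lt_succ_self n
    _ ≤ _ := hF

end

/-- Topological Sard theorem: the set of critical values of a smooth map is meagre. -/
theorem isMeagre_image_critical.{u, v} {E : Type u} [NormedAddCommGroup E] [NormedSpace ℝ E]
    [FiniteDimensional ℝ E] {F : Type v} [NormedAddCommGroup F] [NormedSpace ℝ F]
    [FiniteDimensional ℝ F] {f : E → F} {U : Set E} (hU : IsOpen U)
    (hf : ∀ x ∈ U, ContDiffAt ℝ ∞ f x) :
    IsMeagre (f '' {x ∈ U | ¬ Function.Surjective (fderiv ℝ f x)}) := by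
  induction hn : Module.finrank ℝ E using Nat.strong_induction_on generalizing E F with
  | _ n ih =>
  subst hn
  have : ProperSpace E := FiniteDimensional.proper_real E
  rcases subsingleton_or_nontrivial F with hF | hF
  · convert IsMeagre.empty
    rw [image_eq_empty, eq_empty_iff_forall_notMem]
    exact fun x hx => hx.2 fun y => ⟨0, Subsingleton.elim _ _⟩
  -- points where the derivative does not vanish
  have hA : IsMeagre (f '' {x ∈ U | ¬ Function.Surjective (fderiv ℝ f x) ∧ fderiv ℝ f x ≠ 0}) := by
    refine isMeagre_image_of_locally fun x₀ ⟨hx₀, _, hne⟩ => ?_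
    obtain ⟨u, hu⟩ : ∃ u, fderiv ℝ f x₀ u ≠ 0 := by
      by_contra! h0
      exact hne (ContinuousLinearMap.ext h0)
    obtain ⟨l, hl⟩ := SeparatingDual.exists_ne_zero (R := ℝ) hu
    obtain ⟨v, hv⟩ : ∃ v, l v = 1 := ⟨(l (fderiv ℝ f x₀ u))⁻¹ • fderiv ℝ f x₀ u, by simp [hl]⟩
    have hw : ∀ x ∈ U, ContDiffAt ℝ ∞ (fun x => l (f x)) x := fun x hx =>
      l.contDiff.contDiffAt.comp x (hf x hx)
    have hdw : fderiv ℝ (fun x => l (f x)) x₀ ≠ 0 := by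
      intro h0
      have h1 : HasFDerivAt (fun x => l (f x)) (l ∘L fderiv ℝ f x₀) x₀ :=
        l.hasFDerivAt.comp x₀ ((hf x₀ hx₀).differentiableAt (by simp)).hasFDerivAt
      rw [h1.fderiv] at h0
      exact hl (by simpa using congrArg (fun T => T u) h0)
    obtain ⟨N, hNlt, Φ, hxΦ, hΦU, hΦw, hΦs⟩ := exists_straightening hU hw hx₀ hdw
    obtain ⟨r, hr, hrΦ⟩ :=
      Metric.nhds_basis_closedBall.mem_iff.1 (Φ.open_source.mem_nhds hxΦ)
    set B := Metric.closedBall x₀ r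
    refine ⟨B, Metric.closedBall_mem_nhds x₀ hr, ?_⟩
    have hBc : IsCompact B := isCompact_closedBall x₀ r
    have hcd : ContinuousOn (fderiv ℝ f) B := fun z hz =>
      ((hf z (hΦU (hrΦ hz))).fderiv_right (m := 0) (by simp)).continuousAt.continuousWithinAt
    have hK : IsCompact (B ∩ fderiv ℝ f ⁻¹' {T | Function.Surjective T}ᶜ) := by
      refine hBc.of_isClosed_subset ?_ inter_subset_left
      exact hcd.preimage_isClosed_of_isClosed hBc.isClosed
        isOpen_setOf_surjective.isClosed_compl
    set K := B ∩ fderiv ℝ f ⁻¹' {T | Function.Surjective T}ᶜ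
    refine IsMeagre.mono (t := _) (s := f '' K)
      (image_mono fun x hx => ⟨hx.2, hx.1.2.1⟩) ?_
    have hfK : ContinuousOn f K := fun z hz =>
      (hf z (hΦU (hrΦ hz.1))).continuousAt.continuousWithinAt
    refine (hK.image_of_continuousOn hfK).isMeagre_of_interior_eq_empty ?_
    by_contra hne
    obtain ⟨z₀, hz₀⟩ := nonempty_iff_ne_empty.2 hne
    let t := l z₀
    let Q : F →L[ℝ] l.ker :=
      (ContinuousLinearMap.id ℝ F - l.smulRight v).codRestrict l.ker (by intro x; simp [hv])
    have hQ : ∀ x, ((Q x : l.ker) : F) = x - l x • v := fun x => rfl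
    let O : Set N := {y | (t, y) ∈ Φ.target}
    have hO : IsOpen O := Φ.open_target.preimage (by fun_prop)
    let h : N → l.ker := fun y => Q (f (Φ.symm (t, y)))
    have hmem : ∀ p ∈ Φ.target, Φ.symm p ∈ U := fun p hp => hΦU (Φ.map_target hp)
    have hcomp : ∀ p ∈ Φ.target, ContDiffAt ℝ ∞ (fun p => f (Φ.symm p)) p := fun p hp =>
      (hf _ (hmem p hp)).comp p (hΦs p hp)
    have hh : ∀ y ∈ O, ContDiffAt ℝ ∞ h y := fun y hy =>
      Q.contDiff.contDiffAt.comp y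
        ((hcomp (t, y) hy).comp y (contDiffAt_const.prodMk contDiffAt_id))
    have hm := ih _ hNlt hO hh rfl
    have hW : IsOpen {m : l.ker | t • v + (m : F) ∈ interior (f '' K)} :=
      isOpen_interior.preimage (by fun_prop)
    refine not_isMeagre_of_isOpen hW ⟨Q z₀, ?_⟩ (hm.mono ?_)
    · simpa [hQ, t] using hz₀
    · intro m hmW
      obtain ⟨x, hxK, hxm⟩ := interior_subset hmW
      have hxs := hrΦ hxK.1
      have hlm : l (m : F) = 0 := m.2
      have hfst : (Φ x).1 = t := by rw [hΦw x hxs, hxm]; simp [hv, hlm]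
      have hpair : (t, (Φ x).2) = Φ x := by rw [← hfst]
      have hxt : Φ x ∈ Φ.target := Φ.map_source hxs
      have hsym : Φ.symm (t, (Φ x).2) = x := by rw [hpair, Φ.left_inv hxs]
      refine ⟨(Φ x).2, ⟨show (t, (Φ x).2) ∈ Φ.target by rwa [hpair], fun hsurj => hxK.2 ?_⟩, ?_⟩
      · have hpt : (t, (Φ x).2) ∈ Φ.target := by rwa [hpair]
        have hD1 : HasFDerivAt (fun p => f (Φ.symm p))
            (fderiv ℝ f x ∘L fderiv ℝ Φ.symm (t, (Φ x).2)) (t, (Φ x).2) := by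
          have h1 := ((hf _ (hmem _ hpt)).differentiableAt (by simp)).hasFDerivAt.comp
            (t, (Φ x).2) ((hΦs _ hpt).differentiableAt (by simp)).hasFDerivAt
          rwa [hsym] at h1
        set T := fderiv ℝ f x ∘L fderiv ℝ Φ.symm (t, (Φ x).2)
        have hlT : ∀ q, l (T q) = q.1 := by
          have h1 : HasFDerivAt (fun p => l (f (Φ.symm p))) (l ∘L T) (t, (Φ x).2) :=
            l.hasFDerivAt.comp _ hD1
          have h2 : HasFDerivAt (fun p => l (f (Φ.symm p)))
              (ContinuousLinearMap.fst ℝ ℝ N) (t, (Φ x).2) := by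
            refine hasFDerivAt_fst.congr_of_eventuallyEq ?_
            filter_upwards [Φ.open_target.mem_nhds hpt] with p hp
            rw [← hΦw _ (Φ.map_target hp), Φ.right_inv hp]
          intro q
          exact congrArg (fun T => T q) (h1.unique h2)
        have hD2 : HasFDerivAt h (Q ∘L (T ∘L ContinuousLinearMap.inr ℝ ℝ N)) (Φ x).2 :=
          Q.hasFDerivAt.comp _ (hD1.comp _ (hasFDerivAt_prodMk_right t (Φ x).2))
        rw [hD2.fderiv] at hsurj
        intro z
        have hz : l (z - l z • T (1, 0)) = 0 := by simp [hlT]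
        obtain ⟨n, hn⟩ := hsurj ⟨z - l z • T (1, 0), hz⟩
        have hn' := congrArg (Subtype.val) hn
        have hn'' : T (0, n) = z - l z • T (1, 0) := by
          simpa [hQ, hlT] using hn'
        refine ⟨fderiv ℝ Φ.symm (t, (Φ x).2) ((0, n) + l z • (1, 0)), ?_⟩
        change T ((0, n) + l z • (1, 0)) = z
        rw [map_add, map_smul, hn'']
        abel
      · ext
        simp [h, hsym, hxm, hQ, hv, hlm]
  -- points where the derivative of order `i` vanishes but that of order `i + 1` does not
  have hB : ∀ i, IsMeagre (f '' {x ∈ U | ¬ Function.Surjective (fderiv ℝ f x) ∧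
      iteratedFDeriv ℝ i f x = 0 ∧ iteratedFDeriv ℝ (i + 1) f x ≠ 0}) := by
    intro i
    refine isMeagre_image_of_locally fun x₀ ⟨hx₀, _, _, hne⟩ => ?_
    have hg : ∀ x ∈ U, ContDiffAt ℝ ∞ (iteratedFDeriv ℝ i f) x := fun x hx =>
      (hf x hx).iteratedFDeriv_right (by exact_mod_cast le_top)
    replace hne : fderiv ℝ (iteratedFDeriv ℝ i f) x₀ ≠ 0 := by
      intro h0
      rw [← norm_ne_zero_iff, ← norm_fderiv_iteratedFDeriv, h0] at hne
      exact hne ContinuousLinearMap.opNorm_zero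
    obtain ⟨u, hu⟩ : ∃ u, fderiv ℝ (iteratedFDeriv ℝ i f) x₀ u ≠ 0 := by
      by_contra! h0
      exact hne (ContinuousLinearMap.ext h0)
    obtain ⟨l, hl⟩ := SeparatingDual.exists_ne_zero (R := ℝ) hu
    have hw : ∀ x ∈ U, ContDiffAt ℝ ∞ (fun x => l (iteratedFDeriv ℝ i f x)) x := fun x hx =>
      l.contDiff.contDiffAt.comp x (hg x hx)
    have hdw : fderiv ℝ (fun x => l (iteratedFDeriv ℝ i f x)) x₀ ≠ 0 := by
      intro h0
      have h1 : HasFDerivAt (fun x => l (iteratedFDeriv ℝ i f x))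
          (l ∘L fderiv ℝ (iteratedFDeriv ℝ i f) x₀) x₀ :=
        l.hasFDerivAt.comp x₀ ((hg x₀ hx₀).differentiableAt (by simp)).hasFDerivAt
      rw [h1.fderiv] at h0
      exact hl (by simpa using congrArg (fun T => T u) h0)
    obtain ⟨N, hNlt, Φ, hxΦ, hΦU, hΦw, hΦs⟩ := exists_straightening hU hw hx₀ hdw
    refine ⟨Φ.source, Φ.open_source.mem_nhds hxΦ, ?_⟩
    let O : Set N := {y | ((0 : ℝ), y) ∈ Φ.target}
    have hO : IsOpen O := Φ.open_target.preimage (by fun_prop)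
    have hφ : ∀ y ∈ O, ContDiffAt ℝ ∞ (fun y : N => Φ.symm ((0 : ℝ), y)) y := fun y hy =>
      (hΦs _ hy).comp y (contDiffAt_const.prodMk contDiffAt_id)
    have hmem : ∀ y ∈ O, Φ.symm ((0 : ℝ), y) ∈ U := fun y hy => hΦU (Φ.map_target hy)
    have hm := ih _ hNlt hO (f := fun y : N => f (Φ.symm ((0 : ℝ), y)))
      (fun y hy => (hf _ (hmem y hy)).comp y (hφ y hy)) rfl
    refine hm.mono ?_
    rintro _ ⟨x, ⟨⟨hxU, hxc, hx0, _⟩, hxs⟩, rfl⟩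
    have hpair : ((0 : ℝ), (Φ x).2) = Φ x := by
      ext
      · rw [hΦw x hxs, hx0, map_zero]
      · rfl
    have hyO : (Φ x).2 ∈ O := by
      change ((0 : ℝ), (Φ x).2) ∈ Φ.target
      rw [hpair]
      exact Φ.map_source hxs
    have hsym : Φ.symm ((0 : ℝ), (Φ x).2) = x := by rw [hpair, Φ.left_inv hxs]
    refine ⟨(Φ x).2, ⟨hyO, fun hsurj => hxc ?_⟩, by simp only [hsym]⟩
    have h1 := ((hf _ (hmem _ hyO)).differentiableAt (by simp)).hasFDerivAt.comp
      (Φ x).2 ((hφ _ hyO).differentiableAt (by simp)).hasFDerivAt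
    rw [hsym] at h1
    have h2 := h1.fderiv
    simp only [Function.comp_def] at h2
    rw [h2] at hsurj
    exact Function.Surjective.of_comp hsurj
  refine IsMeagre.mono ?_
    ((hA.union (isMeagre_image_flat hU hf)).union (isMeagre_iUnion fun i : ℕ => hB (i + 1)))
  rintro _ ⟨x, ⟨hxU, hxc⟩, rfl⟩
  by_cases h1 : fderiv ℝ f x = 0
  · by_cases h2 : ∀ i, iteratedFDeriv ℝ (i + 1) f x = 0 → iteratedFDeriv ℝ (i + 2) f x = 0
    · refine Or.inl (Or.inr ⟨x, ⟨hxU, fun i hi => ?_⟩, rfl⟩)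
      induction i, hi using Nat.le_induction with
      | base => rw [← norm_eq_zero, norm_iteratedFDeriv_one, h1, norm_zero]
      | succ i hi hz =>
        obtain ⟨j, rfl⟩ := Nat.exists_eq_add_of_le' hi
        exact h2 j hz
    · push Not at h2
      obtain ⟨i, hi, hi'⟩ := h2
      exact Or.inr (mem_iUnion.2 ⟨i, x, ⟨hxU, hxc, hi, hi'⟩, rfl⟩)
  · exact Or.inl (Or.inl ⟨x, ⟨hxU, hxc, h1⟩, rfl⟩)

/-- Let `E`, `F` be finite-dimensional real normed spaces, `D ⊆ E` open, and
`f : D → F` a `C^∞` function such that `f(D)` has non-empty interior.  Then `f`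
has a regular point: there is `x₀ ∈ D` at which the derivative of `f` is
surjective. -/
theorem statement13
    {E : Type*} [NormedAddCommGroup E] [NormedSpace ℝ E] [FiniteDimensional ℝ E]
    {F : Type*} [NormedAddCommGroup F] [NormedSpace ℝ F] [FiniteDimensional ℝ F]
    (D : Set E) (hD : IsOpen D)
    (f : E → F) (hf : ContDiffOn ℝ (⊤ : ℕ∞) f D)
    (hint : (interior (f '' D)).Nonempty) :
    ∃ x₀ ∈ D, Function.Surjective (fderiv ℝ f x₀) := by
  by_contra! h
  have hm := isMeagre_image_critical hD fun x hx => hf.contDiffAt (hD.mem_nhds hx)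
  refine not_isMeagre_of_isOpen isOpen_interior hint (hm.mono ?_)
  exact interior_subset.trans (image_mono fun x hx => ⟨hx, h x hx⟩)
end

section
/- Let X and F be finite-dimensional real normed vector spaces and let f : X → F be an analytic map possessing at least one regular point, i.e., a point x_0 ∈ X at which the derivative Df(x_0) : X → F is surjective. Let μ be a Borel probability measure on X that is absolutely continuous with respect to Lebesgue measure. Then Df(x) is surjective for μ-almost every x ∈ X. -/
open MeasureTheory

/-- An analytic function on the real line that is not identically zero is nonzero almost
everywhere. -/
theorem ae_ne_zero_of_analyticAt_real {g : ℝ → ℝ} (hg : ∀ t, AnalyticAt ℝ g t) {t₀ : ℝ}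
    (h₀ : g t₀ ≠ 0) : ∀ᵐ t, g t ≠ 0 := by
  rcases AnalyticOnNhd.eqOn_zero_or_eventually_ne_zero_of_preconnected (U := Set.univ)
    (fun t _ ↦ hg t) isPreconnected_univ with h | h
  · exact absurd (h (Set.mem_univ t₀)) h₀
  · rw [← Measure.restrict_univ (μ := volume)]
    exact ae_restrict_le_codiscreteWithin MeasurableSet.univ h

/-- An analytic function on a finite-dimensional real normed space that is not identically zero
is nonzero almost everywhere with respect to any Haar measure. -/
theorem ae_ne_zero_of_analyticAt {E : Type*} [NormedAddCommGroup E] [NormedSpace ℝ E]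
    [FiniteDimensional ℝ E] [MeasurableSpace E] [BorelSpace E] (ν : Measure E)
    [ν.IsAddHaarMeasure] {g : E → ℝ} (hg : ∀ x, AnalyticAt ℝ g x) (h : ∃ x₀, g x₀ ≠ 0) :
    ∀ᵐ x ∂ν, g x ≠ 0 := by
  obtain ⟨x₀, h₀⟩ := h
  have hcont : Continuous g := continuous_iff_continuousAt.2 fun x ↦ (hg x).continuousAt
  have hray : ∀ᵐ v ∂ν, ∀ᵐ t : ℝ, g (x₀ + t • v) ≠ 0 := by
    refine Filter.Eventually.of_forall fun v ↦ ?_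
    refine ae_ne_zero_of_analyticAt_real (g := fun t ↦ g (x₀ + t • v)) (t₀ := 0)
      (fun t ↦ ?_) (by simpa using h₀)
    exact (hg (x₀ + t • v)).fun_comp (f := fun t : ℝ ↦ x₀ + t • v) (by fun_prop)
  have hopen : IsOpen {p : E × ℝ | g (x₀ + p.2 • p.1) ≠ 0} :=
    isOpen_ne_fun (by fun_prop) continuous_const
  have : ProperSpace E := FiniteDimensional.proper ℝ E
  have hswap := (Measure.ae_ae_comm (μ := ν) (ν := volume)
    (p := fun v (t : ℝ) ↦ g (x₀ + t • v) ≠ 0) hopen.measurableSet).1 hray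
  obtain ⟨t, ht, ht₀⟩ := (hswap.and (Measure.ae_ne volume (0 : ℝ))).exists
  have hscale := (Measure.quasiMeasurePreserving_smul ν (inv_ne_zero ht₀)).ae ht
  have htrans := (measurePreserving_sub_right ν x₀).quasiMeasurePreserving.ae hscale
  simpa [smul_inv_smul₀ ht₀] using htrans

/-- If `A` depends analytically on a parameter and `B` is a fixed linear map, then the determinant
of `A ∘ B` depends analytically on the parameter. -/
theorem analyticAt_det_comp {E X F : Type*} [NormedAddCommGroup E] [NormedSpace ℝ E]
    [NormedAddCommGroup X] [NormedSpace ℝ X] [NormedAddCommGroup F] [NormedSpace ℝ F]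
    [FiniteDimensional ℝ F] (B : F →ₗ[ℝ] X) {A : E → X →L[ℝ] F} {x : E}
    (hA : AnalyticAt ℝ A x) :
    AnalyticAt ℝ (fun y ↦ LinearMap.det ((A y : X →ₗ[ℝ] F) ∘ₗ B)) x := by
  let b := Module.finBasis ℝ F
  simp_rw [← LinearMap.det_toMatrix b, Matrix.det_apply, LinearMap.toMatrix_apply]
  refine Finset.analyticAt_fun_sum _ fun σ _ ↦ ?_
  simp_rw [Units.smul_def, zsmul_eq_mul]
  refine analyticAt_const.mul (Finset.analyticAt_fun_prod _ fun i _ ↦ ?_)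
  let L : (X →L[ℝ] F) →L[ℝ] ℝ :=
    (LinearMap.toContinuousLinearMap (b.coord (σ i))).comp
      (ContinuousLinearMap.apply ℝ F (B (b i)))
  exact (L.analyticAt (A x)).fun_comp hA

/-- Let `X`, `F` be finite-dimensional real normed spaces and `f : X → F`
analytic with at least one regular point (a point where the derivative is
surjective).  If `μ` is a Borel probability measure on `X` absolutely
continuous with respect to Lebesgue (Haar) measure, then the derivative of
`f` is surjective at `μ`-almost every point. -/
theorem statement14
    {X : Type*} [NormedAddCommGroup X] [NormedSpace ℝ X] [FiniteDimensional ℝ X]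
    [MeasurableSpace X] [BorelSpace X]
    {F : Type*} [NormedAddCommGroup F] [NormedSpace ℝ F] [FiniteDimensional ℝ F]
    (lebX : Measure X) [lebX.IsAddHaarMeasure]
    (f : X → F) (hfa : ∀ x, AnalyticAt ℝ f x)
    (hreg : ∃ x₀ : X, Function.Surjective (fderiv ℝ f x₀))
    (μ : Measure X) [IsProbabilityMeasure μ] (hμ : μ ≪ lebX) :
    ∀ᵐ x ∂μ, Function.Surjective (fderiv ℝ f x) := by
  obtain ⟨x₀, hx₀⟩ := hreg
  obtain ⟨B, hB⟩ := (fderiv ℝ f x₀ : X →ₗ[ℝ] F).exists_rightInverse_of_surjective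
    (LinearMap.range_eq_top.2 hx₀)
  have hdet : ∀ᵐ x ∂lebX, LinearMap.det ((fderiv ℝ f x : X →ₗ[ℝ] F) ∘ₗ B) ≠ 0 := by
    refine ae_ne_zero_of_analyticAt lebX
      (fun x ↦ analyticAt_det_comp B (hfa x).fderiv) ⟨x₀, ?_⟩
    rw [hB, LinearMap.det_id]
    exact one_ne_zero
  filter_upwards [hμ.ae_le hdet] with x hx
  have hsurj : Function.Surjective ((fderiv ℝ f x : X →ₗ[ℝ] F) ∘ₗ B) :=
    (LinearMap.equivOfDetNeZero _ hx).surjective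
  exact Function.Surjective.of_comp (g := B) hsurj
end

section
/- Let H be a metric space, let F be a finite-dimensional real normed vector space, and let u ↦ ν_u be a map from H to Borel probability measures on F. Fix u_0 ∈ H, and suppose that for every γ > 0 there exist a neighborhood B of u_0 in H, a compact set K ⊂ F, and a continuous non-negative function g : B × F → ℝ with g(u,·) supported in K for all u ∈ B, such that ‖ν_u − g(u,·)ℓ_F‖_var ≤ γ for all u ∈ B, where g(u,·)ℓ_F denotes the measure with density g(u,·) with respect to Lebesgue measure ℓ_F on F. Then the map u ↦ ν_u is continuous at u_0 with respect to the total variation norm. -/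
open MeasureTheory

/-- If `f ≤ g + η` on a measurable set `K` and `f` vanishes off `K`, then the measure with density
`f` exceeds the one with density `g` by at most `η * μ K`. -/
theorem withDensity_ofReal_le_add_of_le_add_on {α : Type*} [MeasurableSpace α] (μ : Measure α)
    {K : Set α} (hK : MeasurableSet K) {f g : α → ℝ} {η : ℝ}
    (hfg : ∀ y ∈ K, f y ≤ g y + η) (hf : ∀ y ∉ K, f y = 0)
    {Γ : Set α} (hΓ : MeasurableSet Γ) :
    μ.withDensity (fun y => ENNReal.ofReal (f y)) Γ ≤
      μ.withDensity (fun y => ENNReal.ofReal (g y)) Γ + ENNReal.ofReal η * μ K := by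
  rw [withDensity_apply _ hΓ, withDensity_apply _ hΓ]
  calc ∫⁻ y in Γ, ENNReal.ofReal (f y) ∂μ
      ≤ ∫⁻ y in Γ, (ENNReal.ofReal (g y) + K.indicator (fun _ => ENNReal.ofReal η) y) ∂μ := by
        refine lintegral_mono fun y => ?_
        by_cases hy : y ∈ K
        · rw [Set.indicator_of_mem hy]
          exact (ENNReal.ofReal_le_ofReal (hfg y hy)).trans ENNReal.ofReal_add_le
        · simp [hf y hy]
    _ = ∫⁻ y in Γ, ENNReal.ofReal (g y) ∂μ
          + ∫⁻ y in Γ, K.indicator (fun _ => ENNReal.ofReal η) y ∂μ :=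
        lintegral_add_right _ (measurable_const.indicator hK)
    _ ≤ _ := by
        gcongr
        refine (setLIntegral_le_lintegral _ _).trans ?_
        rw [lintegral_indicator_const hK]

/-- Densities that vanish off `K` and are uniformly `η`-close on `K` define measures that are
`η * μ K`-close in total variation. -/
theorem abs_withDensity_ofReal_sub_le_of_abs_sub_le_on {α : Type*} [MeasurableSpace α]
    (μ : Measure α) {K : Set α} (hK : MeasurableSet K) (hμK : μ K ≠ ⊤) {f g : α → ℝ} {η C : ℝ}
    (hη : 0 ≤ η) (hfg : ∀ y ∈ K, |f y - g y| ≤ η) (hf : ∀ y ∉ K, f y = 0)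
    (hg : ∀ y ∉ K, g y = 0) (hC : ∀ y ∈ K, g y ≤ C) {Γ : Set α} (hΓ : MeasurableSet Γ) :
    |(μ.withDensity (fun y => ENNReal.ofReal (f y)) Γ).toReal -
      (μ.withDensity (fun y => ENNReal.ofReal (g y)) Γ).toReal| ≤ η * (μ K).toReal := by
  have hmul : ∀ c : ℝ, ENNReal.ofReal c * μ K ≠ ⊤ := fun c =>
    ENNReal.mul_ne_top ENNReal.ofReal_ne_top hμK
  have hle := withDensity_ofReal_le_add_of_le_add_on μ hK (f := f) (g := g) (η := η)
    (fun y hy => by linarith [(abs_le.1 (hfg y hy)).2]) hf hΓ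
  have hge := withDensity_ofReal_le_add_of_le_add_on μ hK (f := g) (g := f) (η := η)
    (fun y hy => by linarith [(abs_le.1 (hfg y hy)).1]) hg hΓ
  have hgfin : μ.withDensity (fun y => ENNReal.ofReal (g y)) Γ ≠ ⊤ := by
    have := withDensity_ofReal_le_add_of_le_add_on μ hK (f := g) (g := fun _ => 0) (η := C)
      (fun y hy => by simpa using hC y hy) hg hΓ
    refine ne_top_of_le_ne_top ?_ this
    simpa using hmul C
  have hffin : μ.withDensity (fun y => ENNReal.ofReal (f y)) Γ ≠ ⊤ :=
    ne_top_of_le_ne_top (ENNReal.add_ne_top.2 ⟨hgfin, hmul η⟩) hle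
  have hle' := ENNReal.toReal_mono (ENNReal.add_ne_top.2 ⟨hgfin, hmul η⟩) hle
  have hge' := ENNReal.toReal_mono (ENNReal.add_ne_top.2 ⟨hffin, hmul η⟩) hge
  rw [ENNReal.toReal_add hgfin (hmul η), ENNReal.toReal_mul, ENNReal.toReal_ofReal hη] at hle'
  rw [ENNReal.toReal_add hffin (hmul η), ENNReal.toReal_mul, ENNReal.toReal_ofReal hη] at hge'
  exact abs_le.2 ⟨by linarith, by linarith⟩

/-- Let `H` be a metric space, `F` a finite-dimensional normed space with
Lebesgue (Haar) measure `ℓ_F`, and `u ↦ ν_u` a family of Borel probability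
measures on `F`.  Suppose that for each `γ > 0` there are a neighbourhood `s`
of `u₀`, a compact `K ⊆ F`, and a continuous non-negative function
`g : s × F → ℝ` with `g(u,·)` supported in `K`, such that
`‖ν_u − g(u,·)ℓ_F‖_var ≤ γ` on `s`.  Then `u ↦ ν_u` is continuous at `u₀` in
the total variation norm. -/
theorem statement17
    {H : Type*} [MetricSpace H]
    {F : Type*} [NormedAddCommGroup F] [NormedSpace ℝ F] [FiniteDimensional ℝ F]
    [MeasurableSpace F] [BorelSpace F]
    (lebF : Measure F) [lebF.IsAddHaarMeasure]
    (ν : H → Measure F) (hν : ∀ u, IsProbabilityMeasure (ν u))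
    (u₀ : H)
    (h : ∀ γ > (0 : ℝ), ∃ s ∈ nhds u₀, ∃ K : Set F, IsCompact K ∧
      ∃ g : H → F → ℝ,
        ContinuousOn (fun p : H × F => g p.1 p.2) (s ×ˢ Set.univ) ∧
        (∀ u ∈ s, ∀ y : F, 0 ≤ g u y) ∧
        (∀ u ∈ s, ∀ y ∉ K, g u y = 0) ∧
        ∀ u ∈ s, ∀ Γ : Set F, MeasurableSet Γ →
          |((ν u) Γ).toReal -
            ((lebF.withDensity (fun y => ENNReal.ofReal (g u y))) Γ).toReal|
            ≤ γ) :
    ∀ ε > (0 : ℝ), ∃ δ > (0 : ℝ), ∀ u : H, dist u u₀ < δ →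
      ∀ Γ : Set F, MeasurableSet Γ →
        |((ν u) Γ).toReal - ((ν u₀) Γ).toReal| ≤ ε := by
  intro ε hε
  obtain ⟨s, hs, K, hK, g, hgc, -, hgK, hgν⟩ := h (ε / 3) (by positivity)
  have hu₀ : u₀ ∈ s := mem_of_mem_nhds hs
  have hμK : lebF K ≠ ⊤ := hK.measure_lt_top.ne
  have hμK0 : 0 ≤ (lebF K).toReal := ENNReal.toReal_nonneg
  set η : ℝ := ε / 3 / ((lebF K).toReal + 1) with hη_def
  have hη : 0 < η := by positivity
  have hηK : η * (lebF K).toReal ≤ ε / 3 := by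
    rw [hη_def, div_mul_eq_mul_div, div_le_iff₀ (by positivity)]
    nlinarith
  obtain ⟨C, hC⟩ : ∃ C, ∀ y ∈ K, g u₀ y ≤ C := by
    have hcont : ContinuousOn (g u₀) K :=
      hgc.comp (f := fun y : F => (u₀, y)) (by fun_prop) fun y _ => ⟨hu₀, Set.mem_univ y⟩
    obtain ⟨C, hC⟩ := hK.exists_bound_of_continuousOn hcont
    exact ⟨C, fun y hy => (le_abs_self _).trans (hC y hy)⟩
  obtain ⟨v, hv, hvη⟩ := hK.mem_uniformity_of_prod (f := g)
    (hgc.mono (Set.prod_mono_right (Set.subset_univ K))) hu₀ (Metric.dist_mem_uniformity hη)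
  rw [nhdsWithin_eq_nhds.2 hs] at hv
  obtain ⟨δ, hδ, hball⟩ := Metric.mem_nhds_iff.1 (Filter.inter_mem hs hv)
  refine ⟨δ, hδ, fun u hu Γ hΓ => ?_⟩
  obtain ⟨hus, huv⟩ := hball hu
  have hclose := abs_withDensity_ofReal_sub_le_of_abs_sub_le_on lebF hK.measurableSet hμK hη.le
    (fun y hy => (hvη u huv y hy).le) (hgK u hus) (hgK u₀ hu₀) hC hΓ
  have hu_approx := abs_le.1 (hgν u hus Γ hΓ)
  have hu₀_approx := abs_le.1 (hgν u₀ hu₀ Γ hΓ)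
  have hclose' := abs_le.1 (hclose.trans hηK)
  exact abs_le.2 ⟨by linarith, by linarith⟩
end

section
/- Let H be a separable Hilbert space, let P be a Markov transition kernel on H, and let μ be a Borel probability measure on H that is stationary for P, i.e., ∫_H P_k(u, Γ) μ(du) = μ(Γ) for every Borel set Γ ⊂ H and every k ≥ 1, where P_k denotes the k-step transition kernel. Let F be a finite-dimensional real normed vector space and π : H → F a continuous linear map. Suppose that for every R > 0 there exists an integer k ≥ 1 such that for every u ∈ H with ‖u‖ ≤ R, the pushforward of the measure P_k(u, ·) under π is absolutely continuous with respect to Lebesgue measure on F. Then the pushforward π_*μ is absolutely continuous with respect to Lebesgue measure on F. -/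
open MeasureTheory ProbabilityTheory

/-- The `k`-step transition kernel obtained by iterating `P`. -/
noncomputable def kernelIter {H : Type*} [MeasurableSpace H]
    (P : Kernel H H) : ℕ → Kernel H H
  | 0 => Kernel.id
  | n + 1 => (kernelIter P n).comp P

theorem isMarkovKernel_kernelIter {H : Type*} [MeasurableSpace H]
    (P : Kernel H H) [IsMarkovKernel P] (k : ℕ) : IsMarkovKernel (kernelIter P k) := by
  induction k with
  | zero => rw [kernelIter]; infer_instance
  | succ n ih => rw [kernelIter]; infer_instance

theorem tendsto_measure_natCast_lt_norm {E : Type*} [NormedAddCommGroup E] [MeasurableSpace E]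
    [OpensMeasurableSpace E] (μ : Measure E) [IsFiniteMeasure μ] :
    Filter.Tendsto (fun n : ℕ => μ {x | (n : ℝ) < ‖x‖}) Filter.atTop (nhds 0) := by
  have hempty : ⋂ n : ℕ, {x : E | (n : ℝ) < ‖x‖} = ∅ := by
    ext x
    obtain ⟨n, hn⟩ := exists_nat_ge ‖x‖
    simpa using ⟨n, hn⟩
  rw [← measure_empty (μ := μ), ← hempty]
  refine tendsto_measure_iInter_atTop
    (fun n => (measurableSet_lt measurable_const measurable_norm).nullMeasurableSet) ?_
    ⟨0, measure_ne_top _ _⟩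
  intro m n hmn x hx
  simp only [Set.mem_ofPred_eq] at hx ⊢
  exact (Nat.cast_le.mpr hmn).trans_lt hx

/-- Let `H` be a separable Hilbert space, `P` a Markov transition kernel on
`H`, and `μ` a stationary Borel probability measure for `P` (so that
`∫ P_k(u, Γ) μ(du) = μ(Γ)` for all `k ≥ 1`).  Let `π : H → F` be a continuous
linear map into a finite-dimensional normed space `F`.  If for every `R > 0`
there is `k ≥ 1` such that for all `u` with `‖u‖ ≤ R` the pushforward of
`P_k(u, ·)` under `π` is absolutely continuous with respect to Lebesgue (Haar)
measure on `F`, then the pushforward `π_* μ` is absolutely continuous with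
respect to Lebesgue (Haar) measure on `F`. -/
theorem statement18
    {H : Type*} [NormedAddCommGroup H] [InnerProductSpace ℝ H] [CompleteSpace H]
    [TopologicalSpace.SeparableSpace H] [MeasurableSpace H] [BorelSpace H]
    {F : Type*} [NormedAddCommGroup F] [NormedSpace ℝ F] [FiniteDimensional ℝ F]
    [MeasurableSpace F] [BorelSpace F]
    (lebF : Measure F) [lebF.IsAddHaarMeasure]
    (P : Kernel H H) [IsMarkovKernel P]
    (μ : Measure H) [IsProbabilityMeasure μ]
    (hstat : ∀ k : ℕ, 1 ≤ k → ∀ Γ : Set H, MeasurableSet Γ →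
      ∫⁻ u, (kernelIter P k) u Γ ∂μ = μ Γ)
    (π : H →L[ℝ] F)
    (habs : ∀ R > (0 : ℝ), ∃ k : ℕ, 1 ≤ k ∧ ∀ u : H, ‖u‖ ≤ R →
      ((kernelIter P k) u).map π ≪ lebF) :
    μ.map π ≪ lebF := by
  refine Measure.AbsolutelyContinuous.mk fun N hN hN0 => ?_
  have hπ : Measurable π := π.continuous.measurable
  rw [Measure.map_apply hπ hN]
  have hbound : ∀ n : ℕ, μ (π ⁻¹' N) ≤ μ {u | ((n + 1 : ℕ) : ℝ) < ‖u‖} := by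
    intro n
    obtain ⟨k, hk, hac⟩ := habs ((n + 1 : ℕ) : ℝ) (by positivity)
    have hMarkov := isMarkovKernel_kernelIter P k
    rw [← hstat k hk _ (hπ hN),
      ← lintegral_indicator_one (measurableSet_lt measurable_const measurable_norm)]
    refine lintegral_mono fun u => ?_
    by_cases hu : ((n + 1 : ℕ) : ℝ) < ‖u‖
    · rw [Set.indicator_of_mem (by exact hu)]
      exact prob_le_one
    · have h0 := hac u (not_lt.mp hu) hN0
      rw [Measure.map_apply hπ hN] at h0
      simp only [h0, zero_le]
  exact le_antisymm (ge_of_tendsto' ((tendsto_measure_natCast_lt_norm μ).comp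
    (Filter.tendsto_add_atTop_nat 1)) hbound) zero_le
end
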